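/- Optimal demixing filter for fixed adjustment vector (Theorem 1, part 1): for every q ∈ ℂ^{M−1}, the vector u*(q) = V_k^{-1} q̃ / sqrt(q̃^H V_k^{-1} q̃), where q̃ = e_k − Ē_k q* (componentwise complex conjugate of q), satisfies ℓ2(u*(q), q) ≤ ℓ2(u, q) for every u ∈ ℂ^M with u^H q̃ ≠ 0 (equivalently, with det T_k(u,q) ≠ 0). Moreover, e^{iθ} u*(q) achieves the same value for every phase θ ∈ [0, 2π]. -/

import Mathlib

open Matrix ComplexOrder

/-- `Ebar k` is the `M × (M-1)` matrix whose columns are all canonical basis vectors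
of `ℂ^M` except the `k`-th one. -/
noncomputable def Ebar {M : ℕ} (k : Fin M) : Matrix (Fin M) {m : Fin M // m ≠ k} ℂ :=
  Matrix.of fun i j => if i = (j : Fin M) then 1 else 0

/-- The IPA update matrix `T_k(u, q) = I + e_k (u - e_k)^H + Ē_k q* e_kᵀ`. -/
noncomputable def Tk {M : ℕ} (k : Fin M) (u : Fin M → ℂ) (q : {m : Fin M // m ≠ k} → ℂ) :
    Matrix (Fin M) (Fin M) ℂ :=
  1 + vecMulVec (Pi.single k 1) (star (u - Pi.single k 1))
    + vecMulVec (Ebar k *ᵥ star q) (Pi.single k 1)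

/-- The surrogate cost
`ℓ2(u, q) = Σ_{m≠k} (e_m + q_m e_k)^H V_m (e_m + q_m e_k) + u^H V_k u - 2 log |det T_k(u, q)|`. -/
noncomputable def ell2 {M : ℕ} (k : Fin M) (V : Fin M → Matrix (Fin M) (Fin M) ℂ)
    (u : Fin M → ℂ) (q : {m : Fin M // m ≠ k} → ℂ) : ℝ :=
  (∑ m : {m : Fin M // m ≠ k},
      (star ((Pi.single (m : Fin M) 1 : Fin M → ℂ) + q m • (Pi.single k 1 : Fin M → ℂ)) ⬝ᵥ
        (V m *ᵥ ((Pi.single (m : Fin M) 1 : Fin M → ℂ) + q m • (Pi.single k 1 : Fin M → ℂ)))).re)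
    + (star u ⬝ᵥ (V k *ᵥ u)).re
    - 2 * Real.log ‖(Tk k u q).det‖

/-- The modified target vector `q̃ = e_k - Ē_k q*`. -/
noncomputable def qtilde {M : ℕ} (k : Fin M) (q : {m : Fin M // m ≠ k} → ℂ) : Fin M → ℂ :=
  Pi.single k 1 - Ebar k *ᵥ star q

/-- The optimal demixing filter `u*(q) = V_k⁻¹ q̃ / sqrt(q̃^H V_k⁻¹ q̃)`. -/
noncomputable def ustar {M : ℕ} (k : Fin M) (V : Fin M → Matrix (Fin M) (Fin M) ℂ)
    (q : {m : Fin M // m ≠ k} → ℂ) : Fin M → ℂ :=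
  ((Real.sqrt ((star (qtilde k q) ⬝ᵥ ((V k)⁻¹ *ᵥ qtilde k q)).re) : ℂ))⁻¹ •
    ((V k)⁻¹ *ᵥ qtilde k q)

lemma Ebar_mulVec_apply_self {M : ℕ} (k : Fin M) (x : {m : Fin M // m ≠ k} → ℂ) :
    (Ebar k *ᵥ x) k = 0 := by
  simp only [mulVec, dotProduct, Ebar, of_apply]
  exact Finset.sum_eq_zero fun j _ => by simp [j.2.symm]

lemma det_one_add_vecMulVec {n : Type*} [Fintype n] [DecidableEq n] (x y : n → ℂ) :
    (1 + vecMulVec x y).det = 1 + y ⬝ᵥ x := by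
  rw [vecMulVec_eq Unit, det_one_add_replicateCol_mul_replicateRow]

/-- The determinant of `T_k(u, q)` is `u^H q̃`. -/
lemma det_Tk {M : ℕ} (k : Fin M) (u : Fin M → ℂ) (q : {m : Fin M // m ≠ k} → ℂ) :
    (Tk k u q).det = star u ⬝ᵥ qtilde k q := by
  have ha := Ebar_mulVec_apply_self k (star q)
  unfold Tk qtilde
  set a := Ebar k *ᵥ star q
  set e : Fin M → ℂ := Pi.single k 1 with he
  set w := star (u - e) with hw
  have hfac : 1 + vecMulVec e w + vecMulVec a e
      = (1 + vecMulVec e (w - (w ⬝ᵥ a) • e)) * (1 + vecMulVec a e) := by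
    have hea : e ⬝ᵥ a = 0 := by simp [he, ha]
    rw [mul_add, mul_one, add_mul, one_mul, vecMulVec_mul_vecMulVec, sub_dotProduct,
      smul_dotProduct, hea]
    ext i j
    simp [vecMulVec_apply]
    ring
  rw [hfac, det_mul, det_one_add_vecMulVec, det_one_add_vecMulVec]
  simp [hw, he, ha, sub_dotProduct, dotProduct_sub]
  ring

lemma ell2_eq {M : ℕ} (k : Fin M) (V : Fin M → Matrix (Fin M) (Fin M) ℂ)
    (q : {m : Fin M // m ≠ k} → ℂ) :
    ∃ C : ℝ, ∀ u, ell2 k V u q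
      = C + (star u ⬝ᵥ (V k *ᵥ u)).re - 2 * Real.log ‖star u ⬝ᵥ qtilde k q‖ :=
  ⟨_, fun u => by rw [ell2, det_Tk]⟩

lemma qtilde_ne_zero {M : ℕ} (k : Fin M) (q : {m : Fin M // m ≠ k} → ℂ) : qtilde k q ≠ 0 := by
  intro h
  have := congrFun h k
  simp [qtilde, Ebar_mulVec_apply_self] at this

/-- The weighted Cauchy–Schwarz inequality `|u^H x|² ≤ (u^H A u) (x^H A⁻¹ x)`. -/
lemma Matrix.PosDef.norm_dotProduct_sq_le {n : Type*} [Fintype n] [DecidableEq n]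
    {A : Matrix n n ℂ} (hA : A.PosDef) (u x : n → ℂ) (hx : x ≠ 0) :
    ‖star u ⬝ᵥ x‖ ^ 2 ≤ (star u ⬝ᵥ (A *ᵥ u)).re * (star x ⬝ᵥ (A⁻¹ *ᵥ x)).re := by
  have hpos := hA.inv.dotProduct_mulVec_pos hx
  obtain ⟨hd, hdi⟩ := Complex.pos_iff.mp hpos
  have hAp : A *ᵥ (A⁻¹ *ᵥ x) = x := by
    rw [mulVec_mulVec, mul_nonsing_inv _ ((isUnit_iff_isUnit_det A).mp hA.isUnit), one_mulVec]
  have hpA : star (A⁻¹ *ᵥ x) ⬝ᵥ (A *ᵥ u) = star (star u ⬝ᵥ x) := by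
    have hvec : star (A⁻¹ *ᵥ x) ᵥ* A = star x := by
      rw [← congrArg star hAp, star_mulVec A, hA.isHermitian.eq]
    rw [dotProduct_mulVec, hvec, star_dotProduct]
  have hpx : star (A⁻¹ *ᵥ x) ⬝ᵥ x = star x ⬝ᵥ (A⁻¹ *ᵥ x) := by
    rw [star_mulVec, hA.inv.isHermitian.eq, dotProduct_mulVec]
  set p := A⁻¹ *ᵥ x
  set d := (star x ⬝ᵥ p).re
  have hdc : star x ⬝ᵥ p = (d : ℂ) := Complex.ext rfl (by simpa using hdi.symm)
  set s := star u ⬝ᵥ x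
  have h := (Complex.nonneg_iff.mp
    (hA.posSemidef.dotProduct_mulVec_nonneg ((d : ℂ) • u - star s • p))).1
  have hexp : star ((d : ℂ) • u - star s • p) ⬝ᵥ (A *ᵥ ((d : ℂ) • u - star s • p))
      = d * (d * (star u ⬝ᵥ (A *ᵥ u)) - s * star s) := by
    simp only [star_sub, star_smul, mulVec_sub, mulVec_smul, sub_dotProduct, dotProduct_sub,
      smul_dotProduct, dotProduct_smul, hAp, hpA, hpx, hdc, smul_eq_mul,
      Complex.star_def, Complex.conj_ofReal]
    ring
  have hss : s * star s = ((‖s‖ ^ 2 : ℝ) : ℂ) := by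
    rw [Complex.star_def, Complex.mul_conj, Complex.normSq_eq_norm_sq]
  rw [hexp, hss, Complex.re_ofReal_mul, Complex.sub_re, Complex.re_ofReal_mul,
    Complex.ofReal_re] at h
  have := nonneg_of_mul_nonneg_right h hd
  linarith

/-- Theorem 1, part 1: for every `q`, the vector `u*(q)` minimizes `u ↦ ℓ2(u, q)` over all
`u` with `u^H q̃ ≠ 0` (equivalently, `det T_k(u, q) ≠ 0`), and every phase rotation
`e^{iθ} u*(q)` achieves the same value. -/
theorem optimal_demixing_filter {M : ℕ} (hM : 2 ≤ M) (k : Fin M)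
    (V : Fin M → Matrix (Fin M) (Fin M) ℂ) (hV : ∀ m, (V m).PosDef)
    (q : {m : Fin M // m ≠ k} → ℂ) :
    (∀ u : Fin M → ℂ, star u ⬝ᵥ qtilde k q ≠ 0 →
        ell2 k V (ustar k V q) q ≤ ell2 k V u q) ∧
    (∀ θ : ℝ, θ ∈ Set.Icc 0 (2 * Real.pi) →
        ell2 k V (Complex.exp (θ * Complex.I) • ustar k V q) q = ell2 k V (ustar k V q) q) := by
  obtain ⟨C, hC⟩ := ell2_eq k V q
  simp only [hC]
  constructor
  · intro u hu
    have hx := qtilde_ne_zero k q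
    have hcs := (hV k).norm_dotProduct_sq_le u (qtilde k q) hx
    obtain ⟨hd, hdi⟩ := Complex.pos_iff.mp ((hV k).inv.dotProduct_mulVec_pos hx)
    have hAp : V k *ᵥ ((V k)⁻¹ *ᵥ qtilde k q) = qtilde k q := by
      rw [mulVec_mulVec, mul_nonsing_inv _ ((isUnit_iff_isUnit_det _).mp (hV k).isUnit),
        one_mulVec]
    have hpx : star ((V k)⁻¹ *ᵥ qtilde k q) ⬝ᵥ qtilde k q
        = star (qtilde k q) ⬝ᵥ ((V k)⁻¹ *ᵥ qtilde k q) := by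
      rw [star_mulVec, (hV k).inv.isHermitian.eq, dotProduct_mulVec]
    unfold ustar
    set x := qtilde k q
    set p := (V k)⁻¹ *ᵥ x
    set d := (star x ⬝ᵥ p).re
    have hdc : star x ⬝ᵥ p = (d : ℂ) := Complex.ext rfl (by simpa using hdi.symm)
    have hr : 0 < √d := Real.sqrt_pos.mpr hd
    have hrr : √d * √d = d := Real.mul_self_sqrt hd.le
    have hs : star (((√d : ℝ) : ℂ)⁻¹ • p) ⬝ᵥ x = ((√d : ℝ) : ℂ) := by
      rw [star_smul, smul_dotProduct, hpx, hdc, star_inv₀, Complex.star_def,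
        Complex.conj_ofReal, smul_eq_mul, ← Complex.ofReal_inv, ← Complex.ofReal_mul]
      congr 1
      field_simp
      nlinarith
    have hquad : star (((√d : ℝ) : ℂ)⁻¹ • p) ⬝ᵥ (V k *ᵥ (((√d : ℝ) : ℂ)⁻¹ • p)) = 1 := by
      rw [mulVec_smul, dotProduct_smul, hAp, hs, smul_eq_mul]
      exact inv_mul_cancel₀ (by exact_mod_cast hr.ne')
    rw [hs, hquad, Complex.norm_of_nonneg hr.le, Complex.one_re]
    set t := (star u ⬝ᵥ (V k *ᵥ u)).re
    have hn : 0 < ‖star u ⬝ᵥ x‖ := norm_pos_iff.mpr hu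
    have ht : 0 < t := pos_of_mul_pos_left (lt_of_lt_of_le (by positivity) hcs) hd.le
    have h1 := Real.log_le_log (by positivity) hcs
    rw [Real.log_pow, Real.log_mul ht.ne' hd.ne'] at h1
    have h2 := Real.log_le_sub_one_of_pos ht
    rw [Real.log_sqrt hd.le]
    push_cast at h1
    linarith
  · intro θ _
    have hc : ‖Complex.exp (θ * Complex.I)‖ = 1 := Complex.norm_exp_ofReal_mul_I θ
    set c := Complex.exp (θ * Complex.I)
    have hcc : star c * c = 1 := by
      rw [Complex.star_def, Complex.conj_mul', hc]; simp
    rw [star_smul, mulVec_smul, smul_dotProduct, smul_dotProduct, dotProduct_smul, smul_smul,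
      hcc, one_smul, norm_smul, norm_star, hc, one_mul]
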